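/- Let α⃗ ∈ {0,1}^m ∖ {(1,…,1)}, let ε = (ε_I)_{I∈𝒟} be a bounded sequence of reals, and let 1 < p_1,…,p_m < ∞ with 1/p = 1/p_1 + ⋯ + 1/p_m. For I ∈ 𝒟 define f_{I,j} = |I|^{−1/p_j} h_I^{1+α_j} for 1 ≤ j ≤ m. Then ‖f_{I,j}‖_{L^{p_j}} = 1 for each j, ⟨f_{I,j}, h_I^{1+α_j}⟩ = |I|^{1−1/p_j}, ⟨f_{I,j}, h_J⟩ = 0 for every dyadic interval J ≠ I whenever α_j = 0, and consequently T_ε^{α⃗}(f_{I,1},…,f_{I,m}) = ε_I |I|^{−1/p} h_I^{σ(α⃗)}, so that ‖T_ε^{α⃗}(f_{I,1},…,f_{I,m})‖_{L^p} = |ε_I|. -/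

import Mathlib

open MeasureTheory Set Filter
open scoped ENNReal NNReal

noncomputable section

/-- The standard dyadic interval `[2^k n, 2^k (n+1))`. -/
def dyad (k n : ℤ) : Set ℝ := Set.Ico ((2:ℝ)^k * (n:ℝ)) ((2:ℝ)^k * ((n:ℝ)+1))

/-- The Haar function of the dyadic interval `dyad k n`:
`1` on the right half, `-1` on the left half. -/
def haar (k n : ℤ) : ℝ → ℝ := fun x =>
  (dyad (k-1) (2*n+1)).indicator (fun _ => (1:ℝ)) x
    - (dyad (k-1) (2*n)).indicator (fun _ => (1:ℝ)) x

/-- `h_I^r` : the Haar function if `r` is odd, the indicator of `I` if `r` is even. -/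
def haarPow (k n : ℤ) (r : ℕ) : ℝ → ℝ :=
  if r % 2 = 1 then haar k n else (dyad k n).indicator (fun _ => (1:ℝ))

/-- `⟨f, g⟩ = ∫ f g`. -/
def ip (f g : ℝ → ℝ) : ℝ := ∫ x, f x * g x

/-- `σ(α)`: the number of components of `α` equal to `0` (i.e. `false`). -/
def sig {m : ℕ} (α : Fin m → Bool) : ℕ :=
  (Finset.univ.filter (fun j => α j = false)).card

/-- A single term (corresponding to the dyadic interval `dyad k n`) of the
multilinear Haar multiplier `T_ε^α`. -/
def haarMultTerm {m : ℕ} (ε : ℤ → ℤ → ℝ) (α : Fin m → Bool) (f : Fin m → ℝ → ℝ)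
    (k n : ℤ) (x : ℝ) : ℝ :=
  ε k n * (∏ j, ip (f j) (haarPow k n (1 + (α j).toNat)) / (2:ℝ)^k)
    * haarPow k n (sig α) x

/-- The multilinear Haar multiplier `T_ε^α`. -/
def haarMult {m : ℕ} (ε : ℤ → ℤ → ℝ) (α : Fin m → Bool) (f : Fin m → ℝ → ℝ) :
    ℝ → ℝ :=
  fun x => ∑' q : ℤ × ℤ, haarMultTerm ε α f q.1 q.2 x

/-- A single term (corresponding to the dyadic interval `dyad k n`) of the
multilinear dyadic paraproduct `π_b^α`. -/
def paraprodTerm {m : ℕ} (b : ℝ → ℝ) (α : Fin m → Bool) (f : Fin m → ℝ → ℝ)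
    (k n : ℤ) (x : ℝ) : ℝ :=
  (ip b (haar k n) / (2:ℝ)^k) * (∏ j, ip (f j) (haarPow k n (1 + (α j).toNat)) / (2:ℝ)^k)
    * haarPow k n (1 + sig α) x

/-- The multilinear dyadic paraproduct `π_b^α`. -/
def paraprod {m : ℕ} (b : ℝ → ℝ) (α : Fin m → Bool) (f : Fin m → ℝ → ℝ) :
    ℝ → ℝ :=
  fun x => ∑' q : ℤ × ℤ, paraprodTerm b α f q.1 q.2 x

/-- The set of endpoints of dyadic intervals. -/
def dyadEndpoints : Set ℝ := {x | ∃ k n : ℤ, x = (2:ℝ)^k * (n:ℝ)}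

/-- The commutator in the `i`-th entry of an `m`-linear operator `T` with a function `b`:
`[b,T]_i(f) = b · T(f) − T(f_1,…,b f_i,…,f_m)`. -/
def commut {m : ℕ} (b : ℝ → ℝ) (T : (Fin m → ℝ → ℝ) → ℝ → ℝ) (i : Fin m) :
    (Fin m → ℝ → ℝ) → ℝ → ℝ :=
  fun f x => b x * T f x - T (Function.update f i (fun y => b y * f i y)) x

/-- The iterated commutator `[b_1,[b_2,⋯[b_{m−1},[b_m, T]_m]_{m−1}⋯]_2]_1`. -/
def iterComm {m : ℕ} (b : Fin m → ℝ → ℝ) (T : (Fin m → ℝ → ℝ) → ℝ → ℝ) :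
    (Fin m → ℝ → ℝ) → ℝ → ℝ :=
  (List.finRange m).foldr (fun i acc => commut (b i) acc i) T

/-- The dyadic BMO norm `‖b‖_{BMO^d}` (with values in `ℝ≥0∞`). -/
def bmoD (b : ℝ → ℝ) : ℝ≥0∞ :=
  ⨆ k : ℤ, ⨆ n : ℤ, ENNReal.ofReal
    (((2:ℝ)^k)⁻¹ * ∫ x in dyad k n, |b x - ((2:ℝ)^k)⁻¹ * ∫ y in dyad k n, b y|)

/-- The BMO norm `‖b‖_{BMO}` over all bounded intervals (with values in `ℝ≥0∞`). -/
def bmo (b : ℝ → ℝ) : ℝ≥0∞ :=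
  ⨆ a : ℝ, ⨆ c : ℝ, ⨆ (_ : a < c), ENNReal.ofReal
    ((c - a)⁻¹ * ∫ x in Set.Ico a c, |b x - (c - a)⁻¹ * ∫ y in Set.Ico a c, b y|)

/-- `b ∈ CMO`: `b` can be approximated in BMO norm by `C_c^∞` functions. -/
def CMO (b : ℝ → ℝ) : Prop :=
  ∀ δ : ℝ, 0 < δ → ∃ g : ℝ → ℝ, ContDiff ℝ (⊤ : ℕ∞) g ∧ HasCompactSupport g ∧
    bmo (fun x => b x - g x) < ENNReal.ofReal δ

/-- Relative compactness (total boundedness) of a set of functions in `L^p(ℝ)`.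
In the complete space `L^p`, this is equivalent to relative compactness. -/
def RelCompLp (p : ℝ) (S : Set (ℝ → ℝ)) : Prop :=
  ∀ δ : ℝ, 0 < δ → ∃ F : Finset (ℝ → ℝ), ∀ f ∈ S, ∃ g ∈ F,
    eLpNorm (fun x => f x - g x) (ENNReal.ofReal p) volume < ENNReal.ofReal δ

end

theorem mem_dyad_iff (k n : ℤ) (x : ℝ) : x ∈ dyad k n ↔ ⌊x / (2:ℝ)^k⌋ = n := by
  have h : (0:ℝ) < (2:ℝ)^k := by positivity
  rw [Int.floor_eq_iff, le_div_iff₀ h, div_lt_iff₀ h, dyad, Set.mem_Ico, mul_comm (n:ℝ),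
    mul_comm ((n:ℝ) + 1)]

theorem floor_div_zpow_add (x : ℝ) (k : ℤ) (d : ℕ) :
    ⌊x / (2:ℝ)^(k + d)⌋ = ⌊x / (2:ℝ)^k⌋ / 2 ^ d := by
  have h := Int.floor_div_natCast (x / (2:ℝ)^k) (2 ^ d)
  push_cast at h
  rw [← h, zpow_add₀ two_ne_zero, zpow_natCast, div_div]

theorem mem_dyad_iff_pred (k n : ℤ) (x : ℝ) :
    x ∈ dyad k n ↔ x ∈ dyad (k-1) (2*n+1) ∨ x ∈ dyad (k-1) (2*n) := by
  have h := floor_div_zpow_add x (k-1) 1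
  simp only [Nat.cast_one, sub_add_cancel, pow_one] at h
  simp only [mem_dyad_iff, h]
  omega

theorem haar_mul_self (k n : ℤ) (x : ℝ) :
    haar k n x * haar k n x = (dyad k n).indicator (fun _ => (1:ℝ)) x := by
  have h1 := mem_dyad_iff_pred k n x
  have h2 : ¬ (x ∈ dyad (k-1) (2*n+1) ∧ x ∈ dyad (k-1) (2*n)) := by
    simp only [mem_dyad_iff]
    omega
  by_cases ha : x ∈ dyad (k-1) (2*n+1) <;> by_cases hb : x ∈ dyad (k-1) (2*n) <;>
    simp_all [haar]

theorem haarPow_mul_self (k n : ℤ) (r : ℕ) (x : ℝ) :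
    haarPow k n r x * haarPow k n r x = (dyad k n).indicator (fun _ => (1:ℝ)) x := by
  unfold haarPow
  split_ifs
  · exact haar_mul_self k n x
  · by_cases h : x ∈ dyad k n <;> simp [h]

theorem norm_haarPow (k n : ℤ) (r : ℕ) (x : ℝ) :
    ‖haarPow k n r x‖ = (dyad k n).indicator (fun _ => (1:ℝ)) x := by
  have h := haarPow_mul_self k n r x
  rw [← abs_mul_abs_self] at h
  rw [Real.norm_eq_abs]
  by_cases hx : x ∈ dyad k n
  · simp only [hx, indicator_of_mem] at h ⊢
    nlinarith [abs_nonneg (haarPow k n r x)]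
  · simpa [hx] using h

theorem haar_eq_zero_of_notMem {k n : ℤ} {x : ℝ} (hx : x ∉ dyad k n) : haar k n x = 0 := by
  have h := haar_mul_self k n x
  rw [indicator_of_notMem hx] at h
  exact mul_self_eq_zero.mp h

theorem measurableSet_dyad (k n : ℤ) : MeasurableSet (dyad k n) := measurableSet_Ico

theorem volume_dyad (k n : ℤ) : volume (dyad k n) = ENNReal.ofReal ((2:ℝ)^k) := by
  rw [dyad, Real.volume_Ico]
  congr 1
  ring

theorem integral_indicator_dyad (k n : ℤ) :
    ∫ x, (dyad k n).indicator (fun _ => (1:ℝ)) x = (2:ℝ)^k := by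
  have h : (0:ℝ) ≤ (2:ℝ)^k := by positivity
  rw [integral_indicator_const _ (measurableSet_dyad k n), measureReal_def, volume_dyad,
    ENNReal.toReal_ofReal h, smul_eq_mul, mul_one]

theorem integrable_indicator_dyad (k n : ℤ) :
    Integrable ((dyad k n).indicator (fun _ => (1:ℝ))) :=
  (integrable_indicator_iff (measurableSet_dyad k n)).2
    (integrableOn_const (by simp [volume_dyad]))

theorem integral_haar (k n : ℤ) : ∫ x, haar k n x = 0 := by
  unfold haar
  rw [integral_sub (integrable_indicator_dyad _ _) (integrable_indicator_dyad _ _),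
    integral_indicator_dyad, integral_indicator_dyad, sub_self]

/-- A Haar function is constant on the dyadic intervals of any strictly smaller scale. -/
theorem haar_eq_of_mem_dyad {k k' : ℤ} (hk : k < k') (n n' : ℤ) {x y : ℝ}
    (hx : x ∈ dyad k n) (hy : y ∈ dyad k n) : haar k' n' x = haar k' n' y := by
  obtain ⟨d, hd⟩ := Int.le.dest (show k ≤ k' - 1 by omega)
  rw [mem_dyad_iff] at hx hy
  have h : ∀ l, x ∈ dyad (k'-1) l ↔ y ∈ dyad (k'-1) l := fun l => by
    rw [mem_dyad_iff, mem_dyad_iff, ← hd, floor_div_zpow_add, floor_div_zpow_add, hx, hy]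
  simp only [haar, indicator_const_eq_indicator_const (h _)]

theorem ip_haar_eq_zero_of_lt {k k' : ℤ} (hk : k < k') (n n' : ℤ) :
    ip (haar k n) (haar k' n') = 0 := by
  have hpos : (0:ℝ) < (2:ℝ)^k := by positivity
  have hc : (2:ℝ)^k * n ∈ dyad k n := by
    rw [dyad, left_mem_Ico]
    nlinarith
  have h : ∀ x, haar k n x * haar k' n' x = haar k n x * haar k' n' ((2:ℝ)^k * n) := fun x => by
    by_cases hx : x ∈ dyad k n
    · rw [haar_eq_of_mem_dyad hk n n' hx hc]
    · rw [haar_eq_zero_of_notMem hx, zero_mul, zero_mul]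
  simp only [ip, h, integral_mul_const, integral_haar, zero_mul]

theorem ip_comm (f g : ℝ → ℝ) : ip f g = ip g f := by
  simp only [ip, mul_comm]

theorem ip_const_mul_left (c : ℝ) (f g : ℝ → ℝ) : ip (fun x => c * f x) g = c * ip f g := by
  simp only [ip, mul_assoc, integral_const_mul]

theorem ip_haar_eq_zero {k n k' n' : ℤ} (h : (k', n') ≠ (k, n)) :
    ip (haar k n) (haar k' n') = 0 := by
  rcases lt_trichotomy k k' with hk | rfl | hk
  · exact ip_haar_eq_zero_of_lt hk n n'
  · have hn : n ≠ n' := fun e => h (by rw [e])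
    have hz : ∀ x, haar k n x * haar k n' x = 0 := fun x => by
      by_cases hx : x ∈ dyad k n
      · have hx' : x ∉ dyad k n' := fun hx' =>
          hn (((mem_dyad_iff k n x).1 hx).symm.trans ((mem_dyad_iff k n' x).1 hx'))
        rw [haar_eq_zero_of_notMem hx', mul_zero]
      · rw [haar_eq_zero_of_notMem hx, zero_mul]
    simp only [ip, hz, integral_zero]
  · rw [ip_comm]
    exact ip_haar_eq_zero_of_lt hk n' n

theorem ip_haarPow_self (k n : ℤ) (r : ℕ) :
    ip (haarPow k n r) (haarPow k n r) = (2:ℝ)^k := by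
  simp only [ip, haarPow_mul_self, integral_indicator_dyad]

theorem eLpNorm_const_mul_haarPow (k n : ℤ) (r : ℕ) (c : ℝ) {q : ℝ} (hq : 0 < q) :
    eLpNorm (fun x => c * haarPow k n r x) (ENNReal.ofReal q) volume
      = ENNReal.ofReal (|c| * ((2:ℝ)^k) ^ (1/q)) := by
  have h : (0:ℝ) < (2:ℝ)^k := by positivity
  have hcongr : eLpNorm (fun x => c * haarPow k n r x) (ENNReal.ofReal q) volume
      = eLpNorm ((dyad k n).indicator (fun _ => c)) (ENNReal.ofReal q) volume := by
    refine eLpNorm_congr_norm_ae (Eventually.of_forall fun x => ?_)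
    rw [norm_mul, norm_haarPow]
    by_cases hx : x ∈ dyad k n <;> simp [hx]
  rw [hcongr, eLpNorm_indicator_const (measurableSet_dyad k n) (by simpa using hq)
    ENNReal.ofReal_ne_top, volume_dyad, ENNReal.toReal_ofReal hq.le,
    ENNReal.ofReal_rpow_of_pos h, ENNReal.ofReal_mul (abs_nonneg c), Real.enorm_eq_ofReal_abs]

/-- The explicit test functions `f_{I,j} = |I|^{-1/p_j} h_I^{1+α_j}`
are unit vectors in `L^{p_j}`, their pairings with Haar functions are as computed,
and `T_ε^α(f_{I,1},…,f_{I,m}) = ε_I |I|^{-1/p} h_I^{σ(α)}`, of `L^p` norm `|ε_I|`. -/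
theorem haar_multiplier_test_functions {m : ℕ}
    (α : Fin m → Bool) (hα : ∃ j, α j = false)
    (ε : ℤ → ℤ → ℝ) (hε : ∃ C : ℝ, ∀ k n : ℤ, |ε k n| ≤ C)
    (pp : Fin m → ℝ) (hpp : ∀ j, 1 < pp j) (p : ℝ) (hp : 1/p = ∑ j, 1/pp j)
    (k n : ℤ) (fI : Fin m → ℝ → ℝ)
    (hfI : fI = fun j x => ((2:ℝ)^k) ^ (-(1/pp j)) * haarPow k n (1 + (α j).toNat) x) :
    (∀ j, eLpNorm (fI j) (ENNReal.ofReal (pp j)) volume = 1) ∧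
    (∀ j, ip (fI j) (haarPow k n (1 + (α j).toNat)) = ((2:ℝ)^k) ^ (1 - 1/pp j)) ∧
    (∀ j, α j = false → ∀ k' n' : ℤ, (k', n') ≠ (k, n) → ip (fI j) (haar k' n') = 0) ∧
    (haarMult ε α fI = fun x => ε k n * ((2:ℝ)^k) ^ (-(1/p)) * haarPow k n (sig α) x) ∧
    eLpNorm (haarMult ε α fI) (ENNReal.ofReal p) volume = ENNReal.ofReal |ε k n| := by
  have hI : (0:ℝ) < (2:ℝ)^k := by positivity
  have hp0 : 0 < p := by
    obtain ⟨j₀, -⟩ := hα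
    have hsum : 0 < ∑ j, 1/pp j :=
      Finset.sum_pos (fun j _ => one_div_pos.2 (one_pos.trans (hpp j))) ⟨j₀, Finset.mem_univ _⟩
    exact one_div_pos.1 (hp ▸ hsum)
  have hcancel : ∀ q : ℝ, ((2:ℝ)^k) ^ (-(1/q)) * ((2:ℝ)^k) ^ (1/q) = 1 := fun q => by
    rw [← Real.rpow_add hI, neg_add_cancel, Real.rpow_zero]
  have hself : ∀ j, ip (fI j) (haarPow k n (1 + (α j).toNat)) = ((2:ℝ)^k) ^ (1 - 1/pp j) :=
    fun j => by
      simp only [hfI]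
      rw [ip_const_mul_left, ip_haarPow_self, sub_eq_neg_add, Real.rpow_add hI, Real.rpow_one]
  have horth : ∀ j, α j = false → ∀ k' n' : ℤ, (k', n') ≠ (k, n) →
      ip (fI j) (haar k' n') = 0 := fun j hj k' n' hne => by
    simp only [hfI]
    rw [ip_const_mul_left, hj, show haarPow k n (1 + false.toNat) = haar k n from rfl,
      ip_haar_eq_zero hne, mul_zero]
  have hT : haarMult ε α fI
      = fun x => ε k n * ((2:ℝ)^k) ^ (-(1/p)) * haarPow k n (sig α) x := by
    funext x
    obtain ⟨j₀, hj₀⟩ := hα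
    have hprod : ∏ j, ip (fI j) (haarPow k n (1 + (α j).toNat)) / (2:ℝ)^k
        = ((2:ℝ)^k) ^ (-(1/p)) := by
      rw [hp, ← Finset.sum_neg_distrib, Real.rpow_sum_of_pos hI]
      refine Finset.prod_congr rfl fun j _ => ?_
      rw [hself, sub_eq_neg_add, Real.rpow_add hI, Real.rpow_one, mul_div_cancel_right₀ _ hI.ne']
    rw [haarMult, tsum_eq_single (k, n)]
    · simp only [haarMultTerm, hprod]
    · rintro ⟨k', n'⟩ hne
      have hz : ∏ j, ip (fI j) (haarPow k' n' (1 + (α j).toNat)) / (2:ℝ)^k' = 0 := by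
        refine Finset.prod_eq_zero (Finset.mem_univ j₀) ?_
        rw [hj₀, show haarPow k' n' (1 + false.toNat) = haar k' n' from rfl,
          horth j₀ hj₀ k' n' hne, zero_div]
      simp only [haarMultTerm, hz, mul_zero, zero_mul]
  refine ⟨fun j => ?_, hself, horth, hT, ?_⟩
  · simp only [hfI]
    rw [eLpNorm_const_mul_haarPow _ _ _ _ (one_pos.trans (hpp j)),
      abs_of_pos (Real.rpow_pos_of_pos hI _), hcancel, ENNReal.ofReal_one]
  · rw [hT, eLpNorm_const_mul_haarPow _ _ _ _ hp0, abs_mul,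
      abs_of_pos (Real.rpow_pos_of_pos hI _), mul_assoc, hcancel, mul_one]
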